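/- arXiv:2105.02502 — 3 statements merged into one kernel-verified Lean document; each statement's English description precedes it below -/
import Mathlib

section
/- Let Λ be an abelian group, δ : Λ → ℤ a surjective homomorphism with kernel Λ₀, and let u₀, …, u_l ∈ Λ satisfy δ(u_i) = c for all i = 0, …, l, where c ≠ 0; set d := |c|. Then the homomorphism Ψ : Λ₀ × ℤ^{l+1} → Λ × ℤ^l defined by Ψ(m, a₀, …, a_l) = (m − Σ_{i=0}^{l} a_i·u_i, (a₀, …, a_{l−1})) is injective and its cokernel is finite of cardinality d. -/
/-- Codimension-one lattice-index computation: let `δ : Λ → ℤ` be surjective with kernel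
`Λ₀`, and let `u₀, …, u_l ∈ Λ` all satisfy `δ(u_i) = c ≠ 0`.  Then the homomorphism
`Ψ : Λ₀ × ℤ^{l+1} → Λ × ℤ^l`, `Ψ(m, a) = (m − Σᵢ aᵢ·uᵢ, (a₀, …, a_{l−1}))`, is injective
with finite cokernel of cardinality `d = |c|`. -/
theorem psi_injective_coker_card {Λ : Type*} [AddCommGroup Λ] (l : ℕ)
    (δ : Λ →+ ℤ) (hδ : Function.Surjective δ)
    (u : Fin (l + 1) → Λ) (c : ℤ) (hc : c ≠ 0) (hu : ∀ i, δ (u i) = c)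
    (Ψ : (δ.ker × (Fin (l + 1) → ℤ)) →+ (Λ × (Fin l → ℤ)))
    (hΨ : ∀ (m : δ.ker) (a : Fin (l + 1) → ℤ),
      Ψ (m, a) = ((m : Λ) - ∑ i, a i • u i, fun j => a j.castSucc)) :
    Function.Injective Ψ ∧ Finite ((Λ × (Fin l → ℤ)) ⧸ Ψ.range) ∧
      Nat.card ((Λ × (Fin l → ℤ)) ⧸ Ψ.range) = c.natAbs := by
  have hδ_sum (a : Fin (l + 1) → ℤ) : δ (∑ i, a i • u i) = (∑ i, a i) * c := by
    simp [map_sum, hu, Finset.sum_mul]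
  have hinj : Function.Injective Ψ := by
    rw [injective_iff_map_eq_zero]
    rintro ⟨m, a⟩ h
    rw [hΨ, Prod.mk_eq_zero] at h
    obtain ⟨hm, ha⟩ := h
    have ha' (j : Fin l) : a j.castSucc = 0 := congrFun ha j
    have hlast : a (Fin.last l) = 0 := by
      have h0 := congrArg δ hm
      rw [map_sub, hδ_sum, m.2, Fin.sum_univ_castSucc] at h0
      simpa [ha', hc] using h0
    have ha0 : a = 0 := funext fun i => Fin.lastCases hlast ha' i
    subst ha0
    simpa using hm
  let φ : Λ × (Fin l → ℤ) →+ ZMod c.natAbs :=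
    (Int.castAddHom (ZMod c.natAbs)).comp (δ.comp (AddMonoidHom.fst _ _))
  have hφ : Function.Surjective φ := by
    intro z
    obtain ⟨n, rfl⟩ := ZMod.intCast_surjective z
    obtain ⟨x, rfl⟩ := hδ n
    exact ⟨(x, 0), rfl⟩
  have hφ_zero (p : Λ × (Fin l → ℤ)) : φ p = 0 ↔ c ∣ δ p.1 := by
    change ((δ p.1 : ℤ) : ZMod c.natAbs) = 0 ↔ _
    rw [ZMod.intCast_zmod_eq_zero_iff_dvd, Int.natAbs_dvd]
  have hrange : Ψ.range = φ.ker := by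
    ext ⟨x, b⟩
    rw [AddMonoidHom.mem_ker, hφ_zero, AddMonoidHom.mem_range]
    constructor
    · rintro ⟨⟨m, a⟩, h⟩
      rw [hΨ] at h
      obtain ⟨rfl, -⟩ := Prod.mk.inj h
      rw [map_sub, hδ_sum, m.2, zero_sub]
      exact (Dvd.intro_left _ rfl).neg_right
    · rintro ⟨k, hk⟩
      let a : Fin (l + 1) → ℤ := Fin.snoc b (-k - ∑ j, b j)
      have ha : ∑ i, a i = -k := by simp [a, Fin.sum_univ_castSucc]
      refine ⟨(⟨x + ∑ i, a i • u i, ?_⟩, a), ?_⟩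
      · rw [AddMonoidHom.mem_ker, map_add, hδ_sum, ha]
        change δ x = c * k at hk
        rw [hk]
        ring
      · rw [hΨ]
        simp [a]
  have e : (Λ × (Fin l → ℤ)) ⧸ Ψ.range ≃+ ZMod c.natAbs :=
    (QuotientAddGroup.quotientAddEquivOfEq hrange).trans
      (QuotientAddGroup.quotientKerEquivOfSurjective φ hφ)
  have : NeZero c.natAbs := ⟨Int.natAbs_ne_zero.mpr hc⟩
  exact ⟨hinj, Finite.of_equiv _ e.symm.toEquiv,
    (Nat.card_congr e.toEquiv).trans (Nat.card_zmod _)⟩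
end

section
/- Let H be a finitely generated abelian group and Q ⊆ H a finitely generated additive submonoid such that Q ∩ (−Q) equals the torsion subgroup of H. Set 𝔪 := Q ∖ (Q ∩ (−Q)), and let I ⊆ 𝔪 be an ideal of Q, i.e. a subset with I + Q ⊆ I. Then the following are equivalent: (1) every element of 𝔪 has a positive multiple lying in I, and no element of Q ∖ 𝔪 has a positive multiple in I (i.e. the radical √I := {q ∈ Q | ∃ n > 0, n·q ∈ I} equals 𝔪); (2) the complement Q ∖ I is finite. -/
/-- If every generator `s ∈ S` has a positive multiple that vanishes or lies in `I`, where `I`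
is stable under adding elements of the closure of `S`, then only finitely many elements of the
closure lie outside `I`. -/
theorem finite_closure_diff_of_nsmul_eq_zero_or_mem {H : Type*} [AddCommMonoid H]
    (S : Finset H) (I : Set H)
    (hI : ∀ x ∈ I, ∀ q ∈ AddSubmonoid.closure (S : Set H), x + q ∈ I)
    (hS : ∀ s ∈ S, ∃ n : ℕ, 0 < n ∧ (n • s = 0 ∨ n • s ∈ I)) :
    ((AddSubmonoid.closure (S : Set H) : Set H) \ I).Finite := by
  classical
  choose! n hn_pos hn using hS
  have hbox : {g : S → ℕ | ∀ s : S, g s ∈ Set.Iio (n s)}.Finite :=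
    Set.Finite.pi' fun s : S => Set.finite_Iio (n s)
  refine (hbox.image fun g => ∑ s : S, g s • (s : H)).subset ?_
  rintro q ⟨hq, hqI⟩
  obtain ⟨f, -, rfl⟩ := AddSubmonoid.mem_closure_finset.1 hq
  refine ⟨fun s => f s % n s, fun s => Nat.mod_lt _ (hn_pos s s.2), ?_⟩
  have hmod : ∀ s ∈ S, (f s % n s) • s = f s • s := by
    intro s hs
    rcases hn s hs with h | h
    · conv_rhs => rw [← Nat.mod_add_div (f s) (n s), add_nsmul, mul_comm, mul_nsmul', h,
        nsmul_zero, add_zero]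
    · rw [Nat.mod_eq_of_lt]
      by_contra! hle
      apply hqI
      rw [← Finset.add_sum_erase S _ hs, ← Nat.add_sub_cancel' hle, add_nsmul, add_assoc]
      refine hI _ h _ (add_mem (nsmul_mem (AddSubmonoid.subset_closure hs) _)
        (sum_mem fun t ht => nsmul_mem (AddSubmonoid.subset_closure ?_) _))
      exact Finset.mem_of_mem_erase ht
  exact (Finset.sum_coe_sort S fun s => (f s % n s) • s).trans (Finset.sum_congr rfl hmod)


open scoped Pointwise in
/-- Let `H` be a finitely generated abelian group and `Q ⊆ H` a finitely generated
submonoid with `Q ∩ (−Q)` equal to the torsion subgroup of `H`.  Set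
`𝔪 := Q ∖ (Q ∩ (−Q))`, and let `I ⊆ 𝔪` be a monoid ideal of `Q`.  Then the radical of
`I` equals `𝔪` if and only if the complement `Q ∖ I` is finite. -/
theorem radical_eq_max_ideal_iff_complement_finite {H : Type*} [AddCommGroup H]
    [AddGroup.FG H]
    (Q : AddSubmonoid H) (hQfg : Q.FG)
    (htor : (Q : Set H) ∩ (-(Q : Set H)) = (AddCommGroup.torsion H : Set H))
    (I : Set H)
    (hIm : I ⊆ (Q : Set H) \ ((Q : Set H) ∩ (-(Q : Set H))))
    (hIdeal : ∀ x ∈ I, ∀ q ∈ Q, x + q ∈ I) :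
    ({x ∈ (Q : Set H) | ∃ n : ℕ, 0 < n ∧ n • x ∈ I} =
        (Q : Set H) \ ((Q : Set H) ∩ (-(Q : Set H)))) ↔
      ((Q : Set H) \ I).Finite := by
  constructor
  · intro hrad
    obtain ⟨S, rfl⟩ := hQfg
    refine finite_closure_diff_of_nsmul_eq_zero_or_mem S I hIdeal fun s hs => ?_
    have hsQ : s ∈ AddSubmonoid.closure (S : Set H) := AddSubmonoid.subset_closure hs
    by_cases hst : s ∈ AddCommGroup.torsion H
    · obtain ⟨n, hn, h⟩ := isOfFinAddOrder_iff_nsmul_eq_zero.1 hst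
      exact ⟨n, hn, Or.inl h⟩
    · rw [htor] at hrad
      obtain ⟨-, n, hn, h⟩ := hrad.symm.subset ⟨hsQ, hst⟩
      exact ⟨n, hn, Or.inr h⟩
  · intro hfin
    rw [htor] at hIm ⊢
    ext x
    constructor
    · rintro ⟨hxQ, n, -, hnx⟩
      exact ⟨hxQ, fun hx => (hIm hnx).2 ((AddCommGroup.torsion H).nsmul_mem hx n)⟩
    · rintro ⟨hxQ, hx⟩
      refine ⟨hxQ, ?_⟩
      by_contra! hxI
      have hinj : Function.Injective fun n : ℕ => n • x :=
        injective_nsmul_iff_not_isOfFinAddOrder.2 hx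
      refine (Set.Ioi_infinite 0).image hinj.injOn (hfin.subset ?_)
      rintro _ ⟨n, hn, rfl⟩
      exact ⟨nsmul_mem hxQ n, hxI n hn⟩
end

section
/- Let A be an abelian group, Q a cancellative commutative additive monoid with Grothendieck group Q^gp, and κ ∈ Q. Let P be the quotient of the additive monoid A × ℕ × ℕ × Q by the monoid congruence generated by the single relation (0, 1, 1, 0) ∼ (0, 0, 0, κ). Then the monoid homomorphism A × ℕ × ℕ × Q → A × ℤ × Q^gp given by (λ, a, b, q) ↦ (λ, a − b, q + b·κ) descends to P, and the induced homomorphism P → A × ℤ × Q^gp is injective. -/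
/-- A congruence identifying `Z₊ + Z₋` with `κ` trades `n` copies of `Z₊ + Z₋` for `n • κ`. -/
theorem AddCon.rel_add_nsmul_of_kink {A Q : Type*} [AddCommGroup A] [AddCommMonoid Q] {κ : Q}
    {c : AddCon (A × ℕ × ℕ × Q)} (h : c (0, 1, 1, 0) (0, 0, 0, κ))
    (lam : A) (a b n : ℕ) (q : Q) :
    c (lam, a + n, b + n, q) (lam, a, b, q + n • κ) := by
  simpa using c.add (c.refl (lam, a, b, q)) (c.nsmul n h)


/-- Let `A` be an abelian group, `Q` a cancellative commutative additive monoid, and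
`(G, ι)` its Grothendieck group `Q^gp` (characterized, for cancellative `Q`, by `ι`
being injective and every element of `G` being a difference of elements in the image of
`ι`).  Let `κ ∈ Q`, let `P` be the quotient of `A × ℕ × ℕ × Q` by the congruence
generated by `(0,1,1,0) ∼ (0,0,0,κ)`, and let `f : A × ℕ × ℕ × Q → A × ℤ × Q^gp` be
`(λ, a, b, q) ↦ (λ, a − b, q + b·κ)`.  Then `f` descends to `P`, and the induced
homomorphism `P → A × ℤ × Q^gp` is injective. -/
theorem kink_monoid_embedding {A Q G : Type*}
    [AddCommGroup A] [AddCancelCommMonoid Q] [AddCommGroup G]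
    (ι : Q →+ G) (hinj : Function.Injective ι)
    (hgen : ∀ g : G, ∃ a b : Q, g = ι a - ι b)
    (κ : Q)
    (c : AddCon (A × ℕ × ℕ × Q))
    (hc : c = addConGen fun x y : A × ℕ × ℕ × Q =>
      x = (0, 1, 1, 0) ∧ y = (0, 0, 0, κ))
    (f : (A × ℕ × ℕ × Q) →+ (A × ℤ × G))
    (hf : ∀ (lam : A) (a b : ℕ) (q : Q),
      f (lam, a, b, q) = (lam, (a : ℤ) - (b : ℤ), ι (q + b • κ))) :
    (∀ x y, c x y → f x = f y) ∧
      ∀ g : c.Quotient →+ A × ℤ × G,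
        (∀ x, g (c.mk' x) = f x) → Function.Injective g := by
  have h_rel : c (0, 1, 1, 0) (0, 0, 0, κ) := hc ▸ AddCon.le_addConGen _ _ ⟨rfl, rfl⟩
  have h_le : c ≤ AddCon.ker f := by
    rw [hc, AddCon.addConGen_le]
    rintro _ _ ⟨rfl, rfl⟩
    simp [AddCon.ker_rel, hf]
  refine ⟨fun x y h => h_le h, fun g hg => ?_⟩
  have h_ker : ∀ x y, f x = f y → x.2.1 ≤ y.2.1 → c x y := by
    rintro ⟨lam, a, b, q⟩ ⟨lam', a', b', q'⟩ h (h_ab : a ≤ a')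
    obtain ⟨n, rfl⟩ := Nat.exists_eq_add_of_le h_ab
    simp only [hf, Prod.mk.injEq, hinj.eq_iff] at h
    obtain ⟨rfl, h_int, h_q⟩ := h
    obtain rfl : b' = b + n := by omega
    obtain rfl : q = q' + n • κ := by
      apply add_right_cancel (b := b • κ)
      rw [h_q, add_nsmul, add_assoc, add_comm (n • κ)]
    exact c.symm (AddCon.rel_add_nsmul_of_kink h_rel lam a b n q')
  intro p p'
  induction p, p' using AddCon.induction_on₂ with | _ x y
  intro h
  have h_eq : f x = f y := by rw [← hg, ← hg]; exact h
  apply c.eq.2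
  rcases le_total x.2.1 y.2.1 with h_ab | h_ab
  · exact h_ker x y h_eq h_ab
  · exact c.symm (h_ker y x h_eq.symm h_ab)
end
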